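/- Let G be a finite simple graph with independence number 3, let a₁ be the number of vertices of G, a₂ the number of 2-element independent sets, and a₃ the number of 3-element independent sets, and let P(z) = a₁z + a₂z² + a₃z³ as a map ℂ → ℂ. If a₂² > 3·a₁·a₃, a₂² = 4·a₃·(a₁ − 1), and a₁ = 5, then the Julia set J(P) is connected. -/

import Mathlib

open Set Topology

/-- The complex plane is unicoherent: two closed connected sets covering it have connected
intersection. -/
theorem isPreconnected_inter_of_union_eq_univ {S T : Set ℂ} (hS : IsClosed S) (hT : IsClosed T)
    (hSc : IsPreconnected S) (hTc : IsPreconnected T) (hST : S ∪ T = univ) :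
    IsPreconnected (S ∩ T) := by
  rw [isPreconnected_iff_subset_of_fully_disjoint_closed (hS.inter hT)]
  intro A B hA hB hAB hdisj
  by_contra! hcon
  obtain ⟨b, hb, hbA⟩ := not_subset.mp hcon.1
  obtain ⟨a, ha, haB⟩ := not_subset.mp hcon.2
  have haA : a ∈ A := (hAB ha).resolve_right haB
  have hbB : b ∈ B := (hAB hb).resolve_left hbA
  obtain ⟨u, hu0, hu1, -⟩ := exists_continuous_zero_one_of_isClosed hA hB hdisj
  have hua : u a = 0 := hu0 haA
  have hub : u b = 1 := hu1 hbB
  classical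
  let f : ℂ → Circle := S.piecewise
    (fun z ↦ Circle.exp (Real.pi * u z)) (fun z ↦ Circle.exp (-(Real.pi * u z)))
  have hfS : EqOn f (fun z ↦ Circle.exp (Real.pi * u z)) S := piecewise_eqOn _ _ _
  have hfT : EqOn f (fun z ↦ Circle.exp (-(Real.pi * u z))) T := by
    intro z hz
    by_cases hzS : z ∈ S
    · rw [hfS hzS]
      rcases hAB ⟨hzS, hz⟩ with h | h
      · have : u z = 0 := hu0 h
        simp [this]
      · have : u z = 1 := hu1 h
        simp only [this, mul_one]
        rw [Circle.exp_eq_exp]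
        exact ⟨1, by push_cast; ring⟩
    · exact piecewise_eqOn_compl _ _ _ hzS
  have hf : Continuous f := by
    rw [← continuousOn_univ, ← hST]
    refine ContinuousOn.union_of_isClosed ?_ ?_ hS hT
    · exact ContinuousOn.congr (by fun_prop) hfS
    · exact ContinuousOn.congr (by fun_prop) hfT
  obtain ⟨θ₀, hθ₀⟩ := Circle.exp_surjective (f a)
  obtain ⟨θ, ⟨-, hθ⟩, -⟩ :=
    Circle.isCoveringMap_exp.existsUnique_continuousMap_lifts ⟨f, hf⟩ a θ₀ hθ₀
  have hθ (z : ℂ) : Circle.exp (θ z) = f z := congrFun hθ z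
  have const_of {R : Set ℂ} (hR : IsPreconnected R) (v : ℂ → ℝ) (hv : Continuous v)
      (h : ∀ z ∈ R, Circle.exp (θ z) = Circle.exp (v z)) (haR : a ∈ R) (hbR : b ∈ R) :
      θ a - v a = θ b - v b := by
    have hdisc : IsDiscrete (AddSubgroup.zmultiples (2 * Real.pi) : Set ℝ) :=
      ⟨inferInstanceAs (DiscreteTopology (AddSubgroup.zmultiples (2 * Real.pi)))⟩
    refine hR.constant_of_mapsTo hdisc
      (f := fun z ↦ θ z - v z) (by fun_prop) (fun z hz ↦ ?_) haR hbR
    obtain ⟨m, hm⟩ := Circle.exp_eq_exp.mp (h z hz)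
    exact ⟨m, by simp [hm]⟩
  have h₁ := const_of hSc (fun z ↦ Real.pi * u z) (by fun_prop)
    (fun z hz ↦ (hθ z).trans (hfS hz)) ha.1 hb.1
  have h₂ := const_of hTc (fun z ↦ -(Real.pi * u z)) (by fun_prop)
    (fun z hz ↦ (hθ z).trans (hfT hz)) ha.2 hb.2
  simp only [hua, hub] at h₁ h₂
  linarith [Real.pi_pos]

/-- A closed connected planar set with connected complement has connected frontier. -/
theorem isPreconnected_frontier {S : Set ℂ} (hS : IsClosed S) (hSc : IsPreconnected S)
    (hSc' : IsPreconnected Sᶜ) : IsPreconnected (frontier S) := by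
  rw [frontier_eq_closure_inter_closure, hS.closure_eq]
  refine isPreconnected_inter_of_union_eq_univ hS isClosed_closure hSc hSc'.closure ?_
  rw [eq_univ_iff_forall]
  exact fun z ↦ (em (z ∈ S)).imp_right fun h ↦ subset_closure h

/-- The intersection of a decreasing sequence of compact connected sets is connected. -/
theorem isPreconnected_iInter_of_antitone {X : Type*} [TopologicalSpace X] [T2Space X]
    {D : ℕ → Set X} (hanti : Antitone D) (hcpt : ∀ n, IsCompact (D n))
    (hconn : ∀ n, IsPreconnected (D n)) : IsPreconnected (⋂ n, D n) := by
  have hclosed : IsClosed (⋂ n, D n) := isClosed_iInter fun n ↦ (hcpt n).isClosed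
  have hK : IsCompact (⋂ n, D n) := (hcpt 0).of_isClosed_subset hclosed (iInter_subset _ 0)
  rw [isPreconnected_iff_subset_of_fully_disjoint_closed hclosed]
  intro A B hA hB hAB hdisj
  obtain ⟨U, V, hU, hV, hAU, hBV, hUV⟩ := SeparatedNhds.of_isCompact_isCompact
    (hK.inter_right hA) (hK.inter_right hB)
    (hdisj.mono inter_subset_right inter_subset_right)
  obtain ⟨n, hn⟩ := exists_subset_nhds_of_isCompact (directed_of_isDirected_le hanti) hcpt
    (U := U ∪ V) fun x hx ↦ (hU.union hV).mem_nhds <|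
      (hAB hx).imp (fun h ↦ hAU ⟨hx, h⟩) (fun h ↦ hBV ⟨hx, h⟩)
  rcases (hconn n).subset_or_subset hU hV hUV hn with h | h
  · refine Or.inl fun x hx ↦ (hAB hx).resolve_right fun hxB ↦ ?_
    exact disjoint_left.mp hUV (h (mem_iInter.mp hx n)) (hBV ⟨hx, hxB⟩)
  · refine Or.inr fun x hx ↦ (hAB hx).resolve_left fun hxA ↦ ?_
    exact disjoint_right.mp hUV (h (mem_iInter.mp hx n)) (hAU ⟨hx, hxA⟩)

/-- The preimage of a closed connected set `F` under an open continuous map is connected as soon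
as it contains a connected set `C` such that the closed subsets of the preimage missing `C` are
compact and do not map onto `F`. -/
theorem IsPreconnected.preimage_of_core {X Y : Type*} [TopologicalSpace X] [TopologicalSpace Y]
    [T2Space Y] {f : X → Y} (hf : Continuous f) (hfo : IsOpenMap f) {F : Set Y} {C : Set X}
    (hFc : IsClosed F) (hF : IsPreconnected F) (hC : IsPreconnected C) (hCF : C ⊆ f ⁻¹' F)
    (hcore : ∀ B ⊆ f ⁻¹' F, IsClosed B → Disjoint C B → IsCompact B ∧ ¬ F ⊆ f '' B) :
    IsPreconnected (f ⁻¹' F) := by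
  have key (u v : Set X) (hu : IsClosed u) (hv : IsClosed v) (huv : f ⁻¹' F ⊆ u ∪ v)
      (hd : Disjoint u v) (hCu : C ⊆ u) : f ⁻¹' F ⊆ u := by
    obtain ⟨hBc, hBF⟩ := hcore (f ⁻¹' F ∩ v) inter_subset_left ((hFc.preimage hf).inter hv)
      (hd.mono hCu inter_subset_right)
    have hcl : IsClosed (f '' uᶜ)ᶜ := (hfo _ hu.isOpen_compl).isClosed_compl
    have hsub : F ⊆ f '' (f ⁻¹' F ∩ v) ∪ (f '' uᶜ)ᶜ := by
      intro y hy
      refine (em (y ∈ f '' uᶜ)).imp (fun h ↦ ?_) id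
      obtain ⟨x, hx, rfl⟩ := h
      exact ⟨x, ⟨hy, (huv hy).resolve_left hx⟩, rfl⟩
    have hdis : Disjoint (f '' (f ⁻¹' F ∩ v)) (f '' uᶜ)ᶜ :=
      disjoint_compl_right_iff_subset.mpr
        (image_mono fun x hx hxu ↦ disjoint_left.mp hd hxu hx.2)
    have := (isPreconnected_iff_subset_of_fully_disjoint_closed hFc).mp hF _ _
      (hBc.image hf).isClosed hcl hsub hdis
    intro x hx
    by_contra hxu
    exact this.resolve_left hBF hx ⟨x, hxu, rfl⟩
  rw [isPreconnected_iff_subset_of_fully_disjoint_closed (hFc.preimage hf)]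
  intro u v hu hv huv hd
  have hC' : C ⊆ u ∨ C ⊆ v := by
    by_contra! h
    obtain ⟨x, hx, hxu⟩ := not_subset.mp h.1
    obtain ⟨y, hy, hyv⟩ := not_subset.mp h.2
    obtain ⟨z, -, hz⟩ := isPreconnected_closed_iff.mp hC u v hu hv (hCF.trans huv)
      ⟨y, hy, (huv (hCF hy)).resolve_right hyv⟩ ⟨x, hx, (huv (hCF hx)).resolve_left hxu⟩
    exact disjoint_left.mp hd hz.1 hz.2
  exact hC'.imp (key u v hu hv huv hd) (key v u hv hu (by rwa [union_comm]) hd.symm)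

/-- The set of points with bounded forward orbit. -/
def filledJulia (P : ℂ → ℂ) : Set ℂ :=
  {z | Bornology.IsBounded (range fun n ↦ P^[n] z)}

/-- The cubic `z (z - 1)²`, whose critical orbits both converge to a parabolic fixed point. -/
def parabolicCubic (z : ℂ) : ℂ := z * (z - 1) ^ 2

namespace parabolicCubic

theorem continuous : Continuous parabolicCubic := by
  unfold parabolicCubic
  fun_prop

theorem isOpenMap : IsOpenMap parabolicCubic := by
  have han : AnalyticOnNhd ℂ parabolicCubic univ := by
    refine Complex.analyticOnNhd_univ_iff_differentiable.mpr ?_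
    unfold parabolicCubic
    fun_prop
  rcases han.is_constant_or_isOpen isPreconnected_univ with ⟨w, hw⟩ | h
  · have h0 := hw 0 (mem_univ _)
    have h2 := hw 2 (mem_univ _)
    norm_num [parabolicCubic] at h0 h2
    simp [← h0] at h2
  · exact fun s hs ↦ h s (subset_univ s) hs

theorem four_mul_norm_le {z : ℂ} (hz : 3 ≤ ‖z‖) : 4 * ‖z‖ ≤ ‖parabolicCubic z‖ := by
  have h : 2 ≤ ‖z - 1‖ := by
    have := norm_sub_norm_le z 1
    rw [norm_one] at this
    linarith
  rw [parabolicCubic, norm_mul, norm_pow]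
  have h4 : 4 ≤ ‖z - 1‖ ^ 2 := by nlinarith
  nlinarith [norm_nonneg z]

theorem four_pow_mul_norm_le {z : ℂ} (hz : 3 ≤ ‖z‖) (n : ℕ) :
    4 ^ n * ‖z‖ ≤ ‖parabolicCubic^[n] z‖ := by
  induction n with
  | zero => simp
  | succ n ih =>
    have h3 : 3 ≤ ‖parabolicCubic^[n] z‖ := by
      nlinarith [one_le_pow₀ (M₀ := ℝ) (a := 4) (by norm_num) (n := n)]
    rw [Function.iterate_succ_apply', pow_succ]
    linarith [four_mul_norm_le h3]

/-- Points whose `n`-th iterate lies in the closed ball of radius `3`. -/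
def inner (n : ℕ) : Set ℂ := {z | ‖parabolicCubic^[n] z‖ ≤ 3}

/-- Points whose `n`-th iterate lies outside the open ball of radius `3`. -/
def outer (n : ℕ) : Set ℂ := {z | 3 ≤ ‖parabolicCubic^[n] z‖}

theorem inner_succ (n : ℕ) : inner (n + 1) = parabolicCubic ⁻¹' inner n := rfl

theorem outer_succ (n : ℕ) : outer (n + 1) = parabolicCubic ⁻¹' outer n := rfl

theorem isClosed_inner (n : ℕ) : IsClosed (inner n) :=
  isClosed_le (continuous.iterate n).norm continuous_const

theorem isClosed_outer (n : ℕ) : IsClosed (outer n) :=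
  isClosed_le continuous_const (continuous.iterate n).norm

theorem antitone_inner : Antitone inner := by
  refine antitone_nat_of_succ_le fun n z hz ↦ ?_
  simp only [inner, mem_ofPred_eq, Function.iterate_succ_apply'] at hz ⊢
  by_contra! h
  linarith [four_mul_norm_le h.le]

theorem monotone_outer : Monotone outer := by
  refine monotone_nat_of_le_succ fun n z hz ↦ ?_
  simp only [outer, mem_ofPred_eq, Function.iterate_succ_apply'] at hz ⊢
  linarith [four_mul_norm_le hz]

theorem inner_zero : inner 0 = Metric.closedBall 0 3 := by
  ext z
  simp [inner]

theorem isCompact_inner (n : ℕ) : IsCompact (inner n) :=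
  (isCompact_closedBall (0 : ℂ) 3).of_isClosed_subset (isClosed_inner n)
    (inner_zero ▸ antitone_inner (Nat.zero_le n))

theorem mapsTo_unitInterval :
    MapsTo parabolicCubic ((↑) '' Icc (0 : ℝ) 1) ((↑) '' Icc (0 : ℝ) 1) := by
  rintro _ ⟨x, ⟨h0, h1⟩, rfl⟩
  refine ⟨x * (x - 1) ^ 2, ⟨by positivity, ?_⟩, by simp [parabolicCubic]⟩
  nlinarith [mul_nonneg h0 (sub_nonneg.mpr h1)]

theorem unitInterval_subset_inner (n : ℕ) : (↑) '' Icc (0 : ℝ) 1 ⊆ inner n := by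
  intro z hz
  obtain ⟨x, ⟨h0, h1⟩, hx⟩ := mapsTo_unitInterval.iterate n hz
  simp only [inner, mem_ofPred_eq, ← hx, Complex.norm_real, Real.norm_eq_abs, abs_of_nonneg h0]
  linarith

theorem isPreconnected_inner (n : ℕ) : IsPreconnected (inner n) := by
  induction n with
  | zero => exact inner_zero ▸ (convex_closedBall (0 : ℂ) 3).isPreconnected
  | succ n ih =>
    refine ih.preimage_of_core continuous isOpenMap (isClosed_inner n)
      (isPreconnected_Icc.image _ Complex.continuous_ofReal.continuousOn)
      (unitInterval_subset_inner (n + 1)) fun B hB hBc hdisj ↦ ⟨?_, fun hsub ↦ ?_⟩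
    · exact (isCompact_inner (n + 1)).of_isClosed_subset hBc hB
    · obtain ⟨b, hb, hb0⟩ := hsub (unitInterval_subset_inner n ⟨0, by simp, rfl⟩)
      refine disjoint_right.mp hdisj hb ?_
      have : b = 0 ∨ b - 1 = 0 := by simpa [parabolicCubic] using hb0
      rcases this with rfl | h
      · exact ⟨0, by simp, by simp⟩
      · exact ⟨1, by simp, by simp [sub_eq_zero.mp h]⟩

theorem isPreconnected_outer_zero : IsPreconnected (outer 0) := by
  have h : IsPreconnected (Ici (3 : ℝ) ×ˢ Metric.sphere (0 : ℂ) 1) :=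
    isPreconnected_Ici.prod (isPreconnected_sphere (by simp [Complex.rank_real_complex]) 0 1)
  convert h.image (fun p ↦ p.1 • p.2) (by fun_prop) using 1
  ext z
  simp only [outer, Function.iterate_zero, id, mem_ofPred_eq, mem_image, mem_prod, mem_Ici,
    mem_sphere_zero_iff_norm, Prod.exists]
  constructor
  · intro hz
    have hz0 : ‖z‖ ≠ 0 := by linarith
    exact ⟨‖z‖, ‖z‖⁻¹ • z, ⟨hz, by simp [hz0]⟩, smul_inv_smul₀ hz0 z⟩
  · rintro ⟨r, w, ⟨hr, hw⟩, rfl⟩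
    simpa [norm_smul, hw] using hr.trans (le_abs_self r)

theorem isPreconnected_outer (n : ℕ) : IsPreconnected (outer n) := by
  induction n with
  | zero => exact isPreconnected_outer_zero
  | succ n ih =>
    refine ih.preimage_of_core continuous isOpenMap (isClosed_outer n)
      isPreconnected_outer_zero (monotone_outer (Nat.zero_le (n + 1)))
      fun B hB hBc hdisj ↦ ?_
    have hBcpt : IsCompact B := by
      refine (isCompact_closedBall (0 : ℂ) 3).of_isClosed_subset hBc fun z hz ↦ ?_
      have : ¬ 3 ≤ ‖z‖ := disjoint_right.mp hdisj hz
      simpa using (not_le.mp this).le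
    refine ⟨hBcpt, fun hsub ↦ ?_⟩
    obtain ⟨M, hM⟩ := (hBcpt.image continuous).isBounded.exists_norm_le
    have hmem : ((max 3 (M + 1) : ℝ) : ℂ) ∈ outer 0 := by
      simp only [outer, Function.iterate_zero, id, mem_ofPred_eq, Complex.norm_real]
      exact (le_max_left _ _).trans (le_abs_self _)
    have := hM _ (hsub (monotone_outer (Nat.zero_le n) hmem))
    rw [Complex.norm_real] at this
    linarith [le_abs_self (max 3 (M + 1)), le_max_right 3 (M + 1), Real.norm_eq_abs (max 3 (M + 1))]

theorem norm_iterate_lt {z : ℂ} (hz : z ∈ filledJulia parabolicCubic) (n : ℕ) :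
    ‖parabolicCubic^[n] z‖ < 3 := by
  by_contra! h
  obtain ⟨M, hM⟩ := Bornology.IsBounded.exists_norm_le (mem_ofPred_eq ▸ hz)
  obtain ⟨m, hm⟩ := pow_unbounded_of_one_lt M (show (1 : ℝ) < 4 by norm_num)
  have h₁ := four_pow_mul_norm_le h m
  rw [← Function.iterate_add_apply] at h₁
  have h₂ := hM _ ⟨m + n, rfl⟩
  nlinarith [pow_pos (show (0 : ℝ) < 4 by norm_num) m]

theorem filledJulia_eq : filledJulia parabolicCubic = ⋂ n, inner n := by
  ext z
  rw [mem_iInter]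
  refine ⟨fun hz n ↦ (norm_iterate_lt hz n).le, fun hz ↦ ?_⟩
  exact isBounded_iff_forall_norm_le.mpr ⟨3, forall_mem_range.mpr hz⟩

theorem compl_filledJulia_eq : (filledJulia parabolicCubic)ᶜ = ⋃ n, outer n := by
  ext z
  rw [mem_iUnion]
  constructor
  · intro hz
    rw [filledJulia_eq, mem_compl_iff, mem_iInter, not_forall] at hz
    obtain ⟨n, hn⟩ := hz
    simp only [inner, mem_ofPred_eq, not_le] at hn
    exact ⟨n, hn.le⟩
  · rintro ⟨n, hn⟩ hz
    exact (norm_iterate_lt hz n).not_ge hn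

theorem isConnected_frontier_filledJulia :
    IsConnected (frontier (filledJulia parabolicCubic)) := by
  have h3 : (3 : ℂ) ∈ outer 0 := by simp [outer]
  refine ⟨nonempty_frontier_iff.mpr ⟨⟨0, ?_⟩, fun h ↦ ?_⟩, isPreconnected_frontier ?_ ?_ ?_⟩
  · rw [filledJulia_eq, mem_iInter]
    exact fun n ↦ unitInterval_subset_inner n ⟨0, by simp, rfl⟩
  · have : (3 : ℂ) ∈ (filledJulia parabolicCubic)ᶜ :=
      compl_filledJulia_eq ▸ mem_iUnion.mpr ⟨0, h3⟩
    simp [h] at this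
  · exact filledJulia_eq ▸ isClosed_iInter isClosed_inner
  · exact filledJulia_eq ▸
      isPreconnected_iInter_of_antitone antitone_inner isCompact_inner isPreconnected_inner
  · rw [compl_filledJulia_eq]
    exact isPreconnected_iUnion ⟨3, mem_iInter.mpr fun n ↦ monotone_outer (Nat.zero_le n) h3⟩
      isPreconnected_outer

/-- Every polynomial affinely conjugate to `parabolicCubic` has connected Julia set. -/
theorem isConnected_frontier_of_semiconj {P : ℂ → ℂ} {c d : ℂ} (hc : c ≠ 0)
    (hP : Function.Semiconj (fun z ↦ c * z + d) P parabolicCubic) :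
    IsConnected (frontier (filledJulia P)) := by
  let e : ℂ ≃ₜ ℂ := (Homeomorph.mulLeft₀ c hc).trans (Homeomorph.addRight d)
  have he (z : ℂ) : e z = c * z + d := rfl
  have hiter (n : ℕ) (z : ℂ) : parabolicCubic^[n] (e z) = c * P^[n] z + d :=
    ((hP.iterate_right n) z).symm
  have hK : filledJulia P = e ⁻¹' filledJulia parabolicCubic := by
    ext z
    simp only [filledJulia, mem_preimage, mem_ofPred_eq, isBounded_iff_forall_norm_le,
      forall_mem_range, hiter]
    constructor
    · rintro ⟨M, hM⟩
      refine ⟨‖c‖ * M + ‖d‖, fun n ↦ (norm_add_le _ _).trans ?_⟩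
      rw [norm_mul]
      gcongr
      exact hM n
    · rintro ⟨M, hM⟩
      refine ⟨‖c‖⁻¹ * (M + ‖d‖), fun n ↦ ?_⟩
      rw [le_inv_mul_iff₀ (norm_pos_iff.mpr hc), ← norm_mul]
      have := norm_sub_le (c * P^[n] z + d) d
      rw [add_sub_cancel_right] at this
      linarith [hM n]
  rw [hK, ← e.preimage_frontier, ← e.image_symm]
  exact isConnected_frontier_filledJulia.image _ e.symm.continuous.continuousOn

end parabolicCubic

/-- For a finite simple graph with independence number 3 whose reduced
independence polynomial is `P(z) = a₁z + a₂z² + a₃z³`, if `a₂² > 3·a₁·a₃`,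
`a₂² = 4·a₃·(a₁ − 1)` and `a₁ = 5`, then the Julia set of `P` is connected. -/
theorem stmt_4 {V : Type*} [Fintype V] [DecidableEq V]
    (G : SimpleGraph V) [DecidableRel G.Adj]
    (a₁ a₂ a₃ : ℕ)
    (ha₁ : a₁ = Fintype.card V)
    (ha₂ : a₂ = (Finset.univ.filter
      (fun s : Finset V => s.card = 2 ∧ ∀ u ∈ s, ∀ v ∈ s, ¬ G.Adj u v)).card)
    (ha₃ : a₃ = (Finset.univ.filter
      (fun s : Finset V => s.card = 3 ∧ ∀ u ∈ s, ∀ v ∈ s, ¬ G.Adj u v)).card)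
    (hindep3 : ∃ s : Finset V, s.card = 3 ∧ ∀ u ∈ s, ∀ v ∈ s, ¬ G.Adj u v)
    (hindep4 : ¬ ∃ s : Finset V, s.card = 4 ∧ ∀ u ∈ s, ∀ v ∈ s, ¬ G.Adj u v)
    (P : ℂ → ℂ)
    (hP : ∀ z, P z = a₁ * z + a₂ * z ^ 2 + a₃ * z ^ 3)
    (hgt : (3 * a₁ * a₃ : ℤ) < (a₂ : ℤ) ^ 2)
    (heq : (a₂ : ℤ) ^ 2 = 4 * a₃ * ((a₁ : ℤ) - 1))
    (ha : a₁ = 5) :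
    IsConnected
      (frontier {z : ℂ | Bornology.IsBounded (Set.range fun n => P^[n] z)}) := by
  have h10 : a₂ ≤ 10 := by
    have h : a₂ ≤ (Finset.powersetCard 2 (Finset.univ : Finset V)).card := by
      rw [ha₂]
      refine Finset.card_le_card fun s hs ↦ ?_
      rw [Finset.mem_filter] at hs
      exact Finset.mem_powersetCard.mpr ⟨Finset.subset_univ s, hs.2.1⟩
    rw [Finset.card_powersetCard, Finset.card_univ, ← ha₁, ha] at h
    exact h
  have hcases : (a₂ = 4 ∧ a₃ = 1) ∨ (a₂ = 8 ∧ a₃ = 4) := by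
    subst ha
    clear ha₂
    interval_cases a₂ <;> norm_num at heq hgt ⊢ <;> omega
  rcases hcases with ⟨h₂, h₃⟩ | ⟨h₂, h₃⟩
  · refine parabolicCubic.isConnected_frontier_of_semiconj (c := 1) (d := 2) one_ne_zero fun z ↦ ?_
    simp only [hP, ha, h₂, h₃, parabolicCubic]
    push_cast
    ring
  · refine parabolicCubic.isConnected_frontier_of_semiconj (c := 2) (d := 2) two_ne_zero fun z ↦ ?_
    simp only [hP, ha, h₂, h₃, parabolicCubic]
    push_cast
    ring
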